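/- For every δ ∈ (0,1) there exists a constant C(δ) > 0 such that for every continuous function φ on [0,π] with max_{x∈[0,π]} |φ(x)| ≤ M, the function u(t,x) = ∫_0^π p(t,x,y) φ(y) dy satisfies, for all r > 0 and all z, h with z, z + h ∈ [0,π] and h > 0, |u(r,z+h) − u(r,z)| ≤ C(δ) M h^δ r^{-(1+δ)/2}. -/

import Mathlib

open Real Set

/-- The Dirichlet heat kernel on `[0, π]`. -/
noncomputable def heatKernel (t x y : ℝ) : ℝ :=
  (2 / Real.pi) * ∑' k : ℕ+, Real.exp (-(k : ℝ) ^ 2 * t) * Real.sin (k * x) * Real.sin (k * y)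

/-- `u(t,x) = ∫_0^π p(t,x,y) φ(y) dy`. -/
noncomputable def heatSol (φ : ℝ → ℝ) (t x : ℝ) : ℝ :=
  ∫ y in (0 : ℝ)..Real.pi, heatKernel t x y * φ y

/-- The partial sums of a sampled Gaussian are bounded by the Gaussian integral. -/
lemma sum_range_exp_neg_mul_succ_sq_le {b : ℝ} (hb : 0 < b) (n : ℕ) :
    ∑ i ∈ Finset.range n, exp (-b * ((i : ℝ) + 1) ^ 2) ≤ √(π / b) / 2 := by
  have hanti : AntitoneOn (fun x : ℝ => exp (-b * x ^ 2)) (Icc 0 (0 + n)) := by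
    intro x hx y _ hxy
    have : x ^ 2 ≤ y ^ 2 := pow_le_pow_left₀ hx.1 hxy 2
    exact exp_le_exp.2 (by nlinarith)
  have hsum := hanti.sum_le_integral
  have hle : ∫ x in (0 : ℝ)..(0 + n), exp (-b * x ^ 2) ≤ √(π / b) / 2 := by
    rw [intervalIntegral.integral_of_le (by positivity), ← integral_gaussian_Ioi]
    exact MeasureTheory.setIntegral_mono_set (integrable_exp_neg_mul_sq hb).integrableOn
      (Filter.Eventually.of_forall fun x => (exp_pos _).le) Ioc_subset_Ioi_self.eventuallyLE
  simpa using hsum.trans hle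

lemma summable_pnat_exp_neg_sq_mul {b : ℝ} (hb : 0 < b) :
    Summable fun k : ℕ+ => exp (-(k : ℝ) ^ 2 * b) := by
  have h := summable_of_sum_range_le (fun i : ℕ => (exp_pos (-b * ((i : ℝ) + 1) ^ 2)).le)
    (sum_range_exp_neg_mul_succ_sq_le hb)
  rw [← Equiv.pnatEquivNat.symm.summable_iff]
  refine h.congr fun i => ?_
  simp [Equiv.pnatEquivNat, mul_comm]

lemma tsum_pnat_exp_neg_sq_mul_le {b : ℝ} (hb : 0 < b) :
    ∑' k : ℕ+, exp (-(k : ℝ) ^ 2 * b) ≤ √(π / b) / 2 := by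
  rw [tsum_pnat_eq_tsum_succ (f := fun k : ℕ => exp (-(k : ℝ) ^ 2 * b))]
  refine Real.tsum_le_of_sum_range_le (fun i => (exp_pos _).le) fun n => ?_
  refine le_of_eq_of_le (Finset.sum_congr rfl fun i _ => ?_)
    (sum_range_exp_neg_mul_succ_sq_le hb n)
  push_cast
  ring_nf

lemma abs_sin_sub_sin_le_rpow {δ : ℝ} (hδ₀ : 0 ≤ δ) (hδ₁ : δ ≤ 1) (a b : ℝ) :
    |sin a - sin b| ≤ 2 * |a - b| ^ δ := by
  rcases le_total 1 |a - b| with h | h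
  · have := one_le_rpow h hδ₀
    have := abs_sub (sin a) (sin b)
    linarith [abs_sin_le_one a, abs_sin_le_one b]
  · have hlip : |sin a - sin b| ≤ |a - b| := by
      simpa [Real.dist_eq] using lipschitzWith_sin.dist_le_mul a b
    have : |a - b| ≤ |a - b| ^ δ := self_le_rpow_of_le_one (abs_nonneg _) h hδ₁
    linarith [abs_nonneg (a - b)]

lemma rpow_mul_exp_neg_sq_mul_le {δ : ℝ} (hδ₀ : 0 ≤ δ) (hδ₁ : δ ≤ 1) {x r : ℝ} (hx : 0 ≤ x)
    (hr : 0 < r) :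
    x ^ δ * exp (-x ^ 2 * r) ≤ 2 * r ^ (-δ / 2) * exp (-x ^ 2 * (r / 2)) := by
  set a := x ^ 2 * r with ha
  have ha₀ : 0 ≤ a := by positivity
  have hxa : x ^ δ = r ^ (-δ / 2) * a ^ (δ / 2) := by
    rw [ha, mul_rpow (by positivity) hr.le, ← rpow_natCast x 2, ← rpow_mul hx, mul_left_comm,
      ← rpow_add hr]
    ring_nf
    simp
  have hpow : a ^ (δ / 2) ≤ 2 * exp (a / 2) := by
    have hexp := add_one_le_exp (a / 2)
    rcases le_total a 1 with h | h
    · linarith [rpow_le_one ha₀ h (by linarith : 0 ≤ δ / 2)]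
    · have := rpow_le_rpow_of_exponent_le h (by linarith : δ / 2 ≤ 1)
      rw [rpow_one] at this
      linarith
  have hexp : exp (-x ^ 2 * (r / 2)) = exp (a / 2) * exp (-x ^ 2 * r) := by
    rw [← exp_add, ha]
    ring_nf
  rw [hxa, hexp]
  calc r ^ (-δ / 2) * a ^ (δ / 2) * exp (-x ^ 2 * r)
      ≤ r ^ (-δ / 2) * (2 * exp (a / 2)) * exp (-x ^ 2 * r) := by gcongr
    _ = _ := by ring

lemma norm_heatKernel_term_le (t x y : ℝ) (k : ℕ+) :
    ‖exp (-(k : ℝ) ^ 2 * t) * sin (k * x) * sin (k * y)‖ ≤ exp (-(k : ℝ) ^ 2 * t) := by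
  rw [norm_mul, norm_mul, norm_of_nonneg (exp_pos _).le, mul_assoc]
  exact mul_le_of_le_one_right (exp_pos _).le
    (mul_le_one₀ (abs_sin_le_one _) (norm_nonneg _) (abs_sin_le_one _))

lemma summable_heatKernel_term {t : ℝ} (ht : 0 < t) (x y : ℝ) :
    Summable fun k : ℕ+ => exp (-(k : ℝ) ^ 2 * t) * sin (k * x) * sin (k * y) :=
  (summable_pnat_exp_neg_sq_mul ht).of_norm_bounded (norm_heatKernel_term_le t x y)

lemma continuous_heatKernel {t : ℝ} (ht : 0 < t) (x : ℝ) : Continuous (heatKernel t x) := by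
  refine continuous_const.mul (continuous_tsum (fun k => by fun_prop)
    (summable_pnat_exp_neg_sq_mul ht) fun k y => norm_heatKernel_term_le t x y k)

/-- The heat kernel is Hölder continuous in space, uniformly in its second argument. -/
lemma abs_heatKernel_sub_le {δ : ℝ} (hδ₀ : 0 ≤ δ) (hδ₁ : δ ≤ 1) {r : ℝ} (hr : 0 < r)
    (x x' y : ℝ) :
    |heatKernel r x y - heatKernel r x' y| ≤
      4 / π * √(2 * π) * |x - x'| ^ δ * r ^ (-(1 + δ) / 2) := by
  have hr₂ : 0 < r / 2 := by positivity
  set K := 4 * |x - x'| ^ δ * r ^ (-δ / 2) with hK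
  have hterm (k : ℕ+) : ‖exp (-(k : ℝ) ^ 2 * r) * sin (k * x) * sin (k * y) -
      exp (-(k : ℝ) ^ 2 * r) * sin (k * x') * sin (k * y)‖ ≤
      K * exp (-(k : ℝ) ^ 2 * (r / 2)) := by
    have hk : (0 : ℝ) ≤ k := by positivity
    have hsin := abs_sin_sub_sin_le_rpow hδ₀ hδ₁ (k * x) (k * x')
    rw [← mul_sub, abs_mul, abs_of_nonneg hk, mul_rpow hk (abs_nonneg _)] at hsin
    rw [← sub_mul, ← mul_sub, norm_mul, norm_mul, norm_of_nonneg (exp_pos _).le]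
    calc exp (-(k : ℝ) ^ 2 * r) * ‖sin (k * x) - sin (k * x')‖ * ‖sin (k * y)‖
        ≤ exp (-(k : ℝ) ^ 2 * r) * (2 * ((k : ℝ) ^ δ * |x - x'| ^ δ)) * 1 := by
          gcongr
          · exact hsin
          · exact abs_sin_le_one _
      _ = 2 * |x - x'| ^ δ * ((k : ℝ) ^ δ * exp (-(k : ℝ) ^ 2 * r)) := by ring
      _ ≤ 2 * |x - x'| ^ δ * (2 * r ^ (-δ / 2) * exp (-(k : ℝ) ^ 2 * (r / 2))) := by
          gcongr 2 * |x - x'| ^ δ * ?_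
          exact rpow_mul_exp_neg_sq_mul_le hδ₀ hδ₁ hk hr
      _ = _ := by rw [hK]; ring
  have hsum := tsum_of_norm_bounded
    ((summable_pnat_exp_neg_sq_mul hr₂).hasSum.mul_left K) hterm
  rw [(summable_heatKernel_term hr x y).tsum_sub (summable_heatKernel_term hr x' y)] at hsum
  have hsqrt : √(π / (r / 2)) = √(2 * π) * r ^ (-(1 : ℝ) / 2) := by
    rw [show π / (r / 2) = 2 * π / r by field_simp, sqrt_div (by positivity), neg_div,
      rpow_neg hr.le, ← sqrt_eq_rpow, div_eq_mul_inv]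
  have hpow : r ^ (-(1 + δ) / 2) = r ^ (-δ / 2) * r ^ (-(1 : ℝ) / 2) := by
    rw [← rpow_add hr]
    ring_nf
  have hK₀ : 0 ≤ K := by positivity
  have hbound := hsum.trans
    (mul_le_mul_of_nonneg_left (tsum_pnat_exp_neg_sq_mul_le hr₂) hK₀)
  rw [hsqrt] at hbound
  unfold heatKernel
  rw [← mul_sub, abs_mul, abs_of_pos (by positivity), hpow]
  refine (mul_le_mul_of_nonneg_left hbound (by positivity)).trans_eq ?_
  rw [hK]
  ring

/-- For every `δ ∈ (0,1)` there is `C(δ) > 0` such that for every continuous `φ` on `[0,π]`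
bounded by `M`, for all `r > 0` and `z, h` with `z, z + h ∈ [0,π]`, `h > 0`:
`|u(r,z+h) − u(r,z)| ≤ C(δ) M h^δ r^{-(1+δ)/2}`. -/
theorem heatSol_holder (δ : ℝ) (hδ : δ ∈ Ioo (0 : ℝ) 1) :
    ∃ C : ℝ, 0 < C ∧ ∀ φ : ℝ → ℝ, ContinuousOn φ (Icc (0 : ℝ) Real.pi) →
      ∀ M : ℝ, (∀ x ∈ Icc (0 : ℝ) Real.pi, |φ x| ≤ M) →
      ∀ r : ℝ, 0 < r → ∀ z h : ℝ,
        z ∈ Icc (0 : ℝ) Real.pi → z + h ∈ Icc (0 : ℝ) Real.pi → 0 < h →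
        |heatSol φ r (z + h) - heatSol φ r z| ≤ C * M * h ^ δ * r ^ (-(1 + δ) / 2) := by
  obtain ⟨hδ₀, hδ₁⟩ := hδ
  refine ⟨4 * √(2 * π), by positivity, fun φ hφ M hM r hr z h _ _ hh => ?_⟩
  have hint (x : ℝ) : IntervalIntegrable (fun y => heatKernel r x y * φ y)
      MeasureTheory.volume 0 π := by
    refine ContinuousOn.intervalIntegrable ?_
    rw [uIcc_of_le pi_pos.le]
    exact (continuous_heatKernel hr x).continuousOn.mul hφ
  unfold heatSol
  rw [← intervalIntegral.integral_sub (hint _) (hint _)]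
  have hbound : ∀ y ∈ uIoc 0 π, ‖heatKernel r (z + h) y * φ y - heatKernel r z y * φ y‖ ≤
      4 / π * √(2 * π) * h ^ δ * r ^ (-(1 + δ) / 2) * M := by
    intro y hy
    rw [uIoc_of_le pi_pos.le] at hy
    have hker := abs_heatKernel_sub_le hδ₀.le hδ₁.le hr (z + h) z y
    rw [add_sub_cancel_left, abs_of_pos hh] at hker
    rw [← sub_mul, norm_mul]
    exact mul_le_mul hker (hM y (Ioc_subset_Icc_self hy)) (norm_nonneg _) (by positivity)
  refine (intervalIntegral.norm_integral_le_of_norm_le_const hbound).trans_eq ?_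
  rw [sub_zero, abs_of_pos pi_pos]
  field_simp
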